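/- arXiv:1201.1733 — 3 statements merged into one kernel-verified Lean document; each statement's English description precedes it below -/
import Mathlib

section
/- Let K be a language over E = E₁ ∪ … ∪ Eₙ (n ≥ 2) and let E_k satisfy ∪_{i≠j}(Eᵢ ∩ Eⱼ) ⊆ E_k ⊆ E. Then K is conditionally decomposable with respect to E₁, …, Eₙ and E_k if and only if there exist languages M_{i+k} ⊆ E_{i+k}* for i = 1, …, n such that K = M_{1+k} ∥ M_{2+k} ∥ … ∥ M_{n+k}. -/
/- Language-theoretic model of discrete-event systems:
   strings over a finite alphabet (a `Finset` of symbols) are lists,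
   natural projections erase letters outside the target alphabet,
   and the parallel composition is the standard synchronous composition. -/

namespace DES

variable {A : Type} [DecidableEq A]

/-- `star E` is `E*`: the set of finite strings over the alphabet `E`. -/
def star (E : Finset A) : Set (List A) :=
  {w | ∀ a ∈ w, a ∈ E}

/-- The natural projection onto `E₀`: it keeps letters of `E₀` and erases all
other letters. -/
def proj (E₀ : Finset A) (w : List A) : List A :=
  w.filter (· ∈ E₀)

/-- The inverse image `P⁻¹(L) = { s ∈ E* : P(s) ∈ L }` of the natural projection
from `E*` onto `E₀*`. -/
def invProj (E E₀ : Finset A) (L : Set (List A)) : Set (List A) :=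
  {s | s ∈ star E ∧ proj E₀ s ∈ L}

/-- Parallel composition `L₁ ∥ L₂ = P₁⁻¹(L₁) ∩ P₂⁻¹(L₂) ⊆ (E₁ ∪ E₂)*` of
`L₁ ⊆ E₁*` and `L₂ ⊆ E₂*`. -/
def par (E₁ E₂ : Finset A) (L₁ L₂ : Set (List A)) : Set (List A) :=
  invProj (E₁ ∪ E₂) E₁ L₁ ∩ invProj (E₁ ∪ E₂) E₂ L₂

/-- Parallel composition of a finite family `L i ⊆ (E i)*`. -/
def parFam {ι : Type} [Fintype ι] (E : ι → Finset A) (L : ι → Set (List A)) :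
    Set (List A) :=
  {w | w ∈ star (Finset.univ.sup E) ∧ ∀ i, proj (E i) w ∈ L i}

/-- The prefix closure of a language. -/
def pref (L : Set (List A)) : Set (List A) :=
  {w | ∃ u, w ++ u ∈ L}

/-- `K` is conditionally decomposable w.r.t. the alphabets `E i` and `Ek`:
`K = P_{1+k}(K) ∥ ⋯ ∥ P_{n+k}(K)`. -/
def condDecomp {ι : Type} [Fintype ι] (E : ι → Finset A) (Ek : Finset A)
    (K : Set (List A)) : Prop :=
  K = parFam (fun i => E i ∪ Ek) (fun i => proj (E i ∪ Ek) '' K)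

/-- Conditional decomposability for two components:
`K = P_{1+k}(K) ∥ P_{2+k}(K)`. -/
def condDecomp2 (E₁ E₂ Ek : Finset A) (K : Set (List A)) : Prop :=
  K = par (E₁ ∪ Ek) (E₂ ∪ Ek) (proj (E₁ ∪ Ek) '' K) (proj (E₂ ∪ Ek) '' K)

/-- The natural projection from `E'*` onto `E₀*` is an `L`-observer. -/
def observer (E' E₀ : Finset A) (L : Set (List A)) : Prop :=
  ∀ t ∈ proj E₀ '' L, ∀ s ∈ pref L, proj E₀ s <+: t →
    ∃ u ∈ star E', s ++ u ∈ L ∧ proj E₀ (s ++ u) = t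

/-- Letter-to-letter renaming map: letters in `Ekeep` are kept, all other
letters are renamed by `g`. -/
def ren (Ekeep : Finset A) (g : A → A) (w : List A) : List A :=
  w.map (fun a => if a ∈ Ekeep then a else g a)


theorem proj_mem_star {A : Type} [DecidableEq A] (E₀ : Finset A) (w : List A) :
    proj E₀ w ∈ star E₀ := by
  intro a ha
  simpa using (List.mem_filter.mp ha).2

theorem star_mono {A : Type} [DecidableEq A] {E₁ E₂ : Finset A} (h : E₁ ⊆ E₂) :
    star E₁ ⊆ star E₂ :=
  fun _ hw a ha => h (hw a ha)

theorem parFam_mono {A : Type} [DecidableEq A] {ι : Type} [Fintype ι] (E : ι → Finset A)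
    {L M : ι → Set (List A)} (h : ∀ i, L i ⊆ M i) : parFam E L ⊆ parFam E M :=
  fun _ hw => ⟨hw.1, fun i => h i (hw.2 i)⟩

/-- A language is contained in the parallel composition of its projections. -/
theorem subset_parFam_image_proj {A : Type} [DecidableEq A] {ι : Type} [Fintype ι]
    (E : ι → Finset A) {K : Set (List A)} (hK : K ⊆ star (Finset.univ.sup E)) :
    K ⊆ parFam E (fun i => proj (E i) '' K) :=
  fun w hw => ⟨hK hw, fun _ => ⟨w, hw, rfl⟩⟩

/-- `K` is conditionally decomposable w.r.t. `E₁, …, Eₙ, E_k` iff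
`K` is a parallel composition of languages `M_{i+k} ⊆ E_{i+k}*`. -/
theorem stmt0 {A : Type} [DecidableEq A] {n : ℕ} (hn : 2 ≤ n)
    (E : Fin n → Finset A) (Ek : Finset A)
    (hs : ∀ i j, i ≠ j → E i ∩ E j ⊆ Ek)
    (hkE : Ek ⊆ Finset.univ.sup E)
    (K : Set (List A)) (hK : K ⊆ star (Finset.univ.sup E)) :
    condDecomp E Ek K ↔
      ∃ M : Fin n → Set (List A),
        (∀ i, M i ⊆ star (E i ∪ Ek)) ∧ K = parFam (fun i => E i ∪ Ek) M := by
  constructor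
  · intro h
    refine ⟨fun i => proj (E i ∪ Ek) '' K, fun i => ?_, h⟩
    rintro _ ⟨w, -, rfl⟩
    exact proj_mem_star _ w
  · rintro ⟨M, -, hM⟩
    refine Set.Subset.antisymm (subset_parFam_image_proj _ (hK.trans (star_mono ?_))) ?_
    · exact Finset.sup_mono_fun fun i _ => Finset.subset_union_left
    · refine (parFam_mono _ fun i => ?_).trans hM.ge
      rintro _ ⟨w, hw, rfl⟩
      rw [hM] at hw
      exact hw.2 i

end DES
end

section
/- Let E₁, E₂, E_k be alphabets with E₁ ∩ E₂ ⊆ E_k ⊆ E₁ ∪ E₂, and let L₁ ⊆ E₁* and L₂ ⊆ E₂* be languages. Then P_k(L₁ ∥ L₂) = P_k(L₁) ∥ P_k(L₂), where P_k : (E₁ ∪ E₂)* → E_k* is the natural projection (and on the right-hand side P_k is applied to languages over E₁ and E₂, erasing all letters not in E_k). -/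
/- Language-theoretic model of discrete-event systems:
   strings over a finite alphabet (a `Finset` of symbols) are lists,
   natural projections erase letters outside the target alphabet,
   and the parallel composition is the standard synchronous composition. -/

namespace DES

variable {A : Type} [DecidableEq A]

theorem proj_cons_of_mem {E : Finset A} {a : A} (h : a ∈ E) (w : List A) :
    proj E (a :: w) = a :: proj E w := by
  simp [proj, h]

theorem proj_cons_of_notMem {E : Finset A} {a : A} (h : a ∉ E) (w : List A) :
    proj E (a :: w) = proj E w := by
  simp [proj, h]

theorem cons_mem_star {E : Finset A} {a : A} {w : List A} :
    a :: w ∈ star E ↔ a ∈ E ∧ w ∈ star E := by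
  simp [star]

/-- If no letter outside `Ek` leads `u`, then a letter `c ∈ Ek` leading `w` can be removed from
`w` and, when `c ∈ E`, also from `u`. -/
theorem exists_tail_of_proj_eq {E Ek : Finset A} {c : A} {w u : List A} (hc : c ∈ Ek)
    (hu : u ∈ star E) (hk : ¬∃ a u', u = a :: u' ∧ a ∉ Ek)
    (eu : proj Ek u = proj (E ∩ Ek) (c :: w)) :
    ∃ u' ∈ star E, proj Ek u' = proj (E ∩ Ek) w ∧
      u'.length ≤ u.length ∧ u = if c ∈ E then c :: u' else u' := by
  by_cases hcE : c ∈ E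
  · rw [proj_cons_of_mem (Finset.mem_inter.2 ⟨hcE, hc⟩)] at eu
    cases u with
    | nil => simp [proj] at eu
    | cons a u =>
      rw [proj_cons_of_mem (by_contra fun ha => hk ⟨a, u, rfl, ha⟩)] at eu
      obtain ⟨rfl, eu'⟩ := List.cons.inj eu
      exact ⟨u, (cons_mem_star.1 hu).2, eu', by simp, by simp [hcE]⟩
  · rw [proj_cons_of_notMem (by simp [hcE])] at eu
    exact ⟨u, hu, eu, le_rfl, by simp [hcE]⟩

theorem eq_nil_of_proj_eq_nil {Ek : Finset A} {u : List A}
    (hk : ¬∃ a u', u = a :: u' ∧ a ∉ Ek) (eu : proj Ek u = []) : u = [] := by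
  cases u with
  | nil => rfl
  | cons a u =>
    rw [proj_cons_of_mem (by_contra fun ha => hk ⟨a, u, rfl, ha⟩)] at eu
    simp at eu

/-- Strings over `E₁` and `E₂` whose projections onto `Ek` agree with those of `w` admit a
common interleaving that projects onto `w`. -/
theorem exists_interleaving {E₁ E₂ Ek : Finset A} (h : E₁ ∩ E₂ ⊆ Ek) :
    ∀ {w u v : List A}, w ∈ star ((E₁ ∩ Ek) ∪ (E₂ ∩ Ek)) → u ∈ star E₁ → v ∈ star E₂ →
      proj Ek u = proj (E₁ ∩ Ek) w → proj Ek v = proj (E₂ ∩ Ek) w →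
      ∃ s ∈ star (E₁ ∪ E₂), proj E₁ s = u ∧ proj E₂ s = v ∧ proj Ek s = w := by
  intro w u v hw hu hv eu ev
  induction hn : w.length + u.length + v.length using Nat.strong_induction_on
    generalizing w u v with
  | _ n ih =>
  subst hn
  by_cases hau : ∃ a u', u = a :: u' ∧ a ∉ Ek
  · obtain ⟨a, u, rfl, ha⟩ := hau
    rw [cons_mem_star] at hu
    have ha₂ : a ∉ E₂ := fun ha₂ => ha (h (Finset.mem_inter.2 ⟨hu.1, ha₂⟩))
    rw [proj_cons_of_notMem ha] at eu
    obtain ⟨s, hs, e₁, e₂, ek⟩ := ih _ (by simp) hw hu.2 hv eu ev rfl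
    refine ⟨a :: s, cons_mem_star.2 ⟨Finset.mem_union_left _ hu.1, hs⟩, ?_, ?_, ?_⟩
    · rw [proj_cons_of_mem hu.1, e₁]
    · rw [proj_cons_of_notMem ha₂, e₂]
    · rw [proj_cons_of_notMem ha, ek]
  by_cases hbv : ∃ b v', v = b :: v' ∧ b ∉ Ek
  · obtain ⟨b, v, rfl, hb⟩ := hbv
    rw [cons_mem_star] at hv
    have hb₁ : b ∉ E₁ := fun hb₁ => hb (h (Finset.mem_inter.2 ⟨hb₁, hv.1⟩))
    rw [proj_cons_of_notMem hb] at ev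
    obtain ⟨s, hs, e₁, e₂, ek⟩ := ih _ (by simp) hw hu hv.2 eu ev rfl
    refine ⟨b :: s, cons_mem_star.2 ⟨Finset.mem_union_right _ hv.1, hs⟩, ?_, ?_, ?_⟩
    · rw [proj_cons_of_notMem hb₁, e₁]
    · rw [proj_cons_of_mem hv.1, e₂]
    · rw [proj_cons_of_notMem hb, ek]
  cases w with
  | nil =>
    obtain rfl := eq_nil_of_proj_eq_nil hau eu
    obtain rfl := eq_nil_of_proj_eq_nil hbv ev
    exact ⟨[], by simp [star], rfl, rfl, rfl⟩
  | cons c w =>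
    rw [cons_mem_star] at hw
    obtain ⟨hc, hw⟩ := hw
    have hck : c ∈ Ek := by simp at hc; tauto
    have hcE : c ∈ E₁ ∪ E₂ := by simp at hc ⊢; tauto
    obtain ⟨u', hu', eu', hlu, hcu⟩ := exists_tail_of_proj_eq hck hu hau eu
    obtain ⟨v', hv', ev', hlv, hcv⟩ := exists_tail_of_proj_eq hck hv hbv ev
    obtain ⟨s, hs, e₁, e₂, ek⟩ :=
      ih _ (by simp only [List.length_cons]; omega) hw hu' hv' eu' ev' rfl
    refine ⟨c :: s, cons_mem_star.2 ⟨hcE, hs⟩, ?_, ?_, ?_⟩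
    · rw [hcu, ← e₁]
      split_ifs with hc₁
      exacts [proj_cons_of_mem hc₁ s, proj_cons_of_notMem hc₁ s]
    · rw [hcv, ← e₂]
      split_ifs with hc₂
      exacts [proj_cons_of_mem hc₂ s, proj_cons_of_notMem hc₂ s]
    · rw [proj_cons_of_mem hck, ek]

/-- Wonham's lemma: if `E₁ ∩ E₂ ⊆ E_k ⊆ E₁ ∪ E₂` then
`P_k(L₁ ∥ L₂) = P_k(L₁) ∥ P_k(L₂)`, where `P_k(Lᵢ)` is a language over
`Eᵢ ∩ E_k`. -/
theorem stmt3 {A : Type} [DecidableEq A] (E₁ E₂ Ek : Finset A)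
    (h1 : E₁ ∩ E₂ ⊆ Ek) (h2 : Ek ⊆ E₁ ∪ E₂)
    (L₁ L₂ : Set (List A)) (hL₁ : L₁ ⊆ star E₁) (hL₂ : L₂ ⊆ star E₂) :
    proj Ek '' par E₁ E₂ L₁ L₂ =
      par (E₁ ∩ Ek) (E₂ ∩ Ek) (proj Ek '' L₁) (proj Ek '' L₂) := by
  ext w
  constructor
  · rintro ⟨s, ⟨⟨hs, hs₁⟩, -, hs₂⟩, rfl⟩
    have hw : proj Ek s ∈ star ((E₁ ∩ Ek) ∪ (E₂ ∩ Ek)) := by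
      intro a ha
      have ha : a ∈ s ∧ a ∈ Ek := by simpa [proj] using ha
      rw [← Finset.union_inter_distrib_right]
      exact Finset.mem_inter.2 ⟨hs a ha.1, ha.2⟩
    have key : ∀ E : Finset A, proj Ek (proj E s) = proj (E ∩ Ek) (proj Ek s) := by
      intro E
      simp only [proj, List.filter_filter]
      refine List.filter_congr fun a _ => ?_
      by_cases ha : a ∈ Ek <;> simp [ha]
    exact ⟨⟨hw, _, hs₁, key E₁⟩, hw, _, hs₂, key E₂⟩
  · rintro ⟨⟨hw, u, hu, eu⟩, -, v, hv, ev⟩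
    obtain ⟨s, hs, rfl, rfl, rfl⟩ := exists_interleaving h1 hw (hL₁ hu) (hL₂ hv) eu ev
    exact ⟨s, ⟨⟨hs, hu⟩, hs, hv⟩, rfl⟩

end DES
end

section
/- Let n ≥ 2, let E₁, …, Eₙ be alphabets, let E_s = ∪_{i≠j}(Eᵢ ∩ Eⱼ), and let E_k satisfy E_s ⊆ E_k ⊆ E := E₁ ∪ … ∪ Eₙ. For i = 1, …, n let Kᵢ ⊆ Eᵢ* and K_k ⊆ E_k* be languages (the marked languages of generators Gᵢ and of a coordinator G_k), and set K = K₁ ∥ … ∥ Kₙ ∥ K_k. If for every i = 1, …, n the natural projection P^{i+k}_k : E_{i+k}* → E_k* is a P_{i+k}(K)-observer, then overline(K) is conditionally decomposable with respect to E₁, …, Eₙ and E_k. -/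
/- Language-theoretic model of discrete-event systems:
   strings over a finite alphabet (a `Finset` of symbols) are lists,
   natural projections erase letters outside the target alphabet,
   and the parallel composition is the standard synchronous composition. -/

namespace DES

variable {A : Type} [DecidableEq A]

theorem proj_append (E : Finset A) (v w : List A) :
    proj E (v ++ w) = proj E v ++ proj E w :=
  List.filter_append ..

theorem proj_eq_self {E : Finset A} {w : List A} (h : w ∈ star E) : proj E w = w :=
  List.filter_eq_self.2 fun a ha => by simpa using h a ha

theorem proj_proj_of_subset {E F : Finset A} (h : E ⊆ F) (w : List A) :
    proj E (proj F w) = proj E w := by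
  unfold proj
  rw [List.filter_filter]
  refine List.filter_congr fun a _ => ?_
  have := @h a
  by_cases ha : a ∈ E <;> simp_all

omit [DecidableEq A] in
theorem star_mono_s15 {E F : Finset A} (h : E ⊆ F) : star E ⊆ star F :=
  fun _ hw a ha => h (hw a ha)

omit [DecidableEq A] in
theorem append_mem_star {E : Finset A} {v w : List A} :
    v ++ w ∈ star E ↔ v ∈ star E ∧ w ∈ star E := by
  simp [star, or_imp, forall_and]

/-- Two strings that agree on their common letters have a common interleaving. -/
theorem exists_merge (X Y : Finset A) (x : List A) : ∀ y : List A, x ∈ star X → y ∈ star Y →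
    proj Y x = proj X y → ∃ z ∈ star (X ∪ Y), proj X z = x ∧ proj Y z = y := by
  induction x with
  | nil =>
    intro y _ hy h
    exact ⟨y, star_mono_s15 Finset.subset_union_right hy, h.symm, proj_eq_self hy⟩
  | cons a x ih =>
    intro y hx hy h
    have haX : a ∈ X := hx a (by simp)
    have hx' : x ∈ star X := fun b hb => hx b (by simp [hb])
    by_cases haY : a ∈ Y
    · have h' : proj X y = a :: proj Y x := by
        rw [← h]
        simp [proj, haY]
      obtain ⟨y₁, y₂, rfl, hy₁, -, h₂⟩ := List.filter_eq_cons_iff.1 h'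
      rw [append_mem_star] at hy
      obtain ⟨z, hz, hzX, hzY⟩ := ih y₂ hx' (fun b hb => hy.2 b (by simp [hb])) h₂.symm
      have hnil : proj X y₁ = [] := List.filter_eq_nil_iff.2 hy₁
      refine ⟨y₁ ++ a :: z, ?_, ?_, ?_⟩
      · refine append_mem_star.2 ⟨star_mono_s15 Finset.subset_union_right hy.1, ?_⟩
        intro b hb
        rcases List.mem_cons.1 hb with rfl | hb
        · exact Finset.mem_union_left _ haX
        · exact hz b hb
      · rw [proj_append, hnil, ← hzX]
        simp [proj, haX]
      · rw [proj_append, proj_eq_self hy.1]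
        rw [← hzY]
        simp [proj, haY]
    · obtain ⟨z, hz, hzX, hzY⟩ := ih y hx' hy (by rw [← h]; simp [proj, haY])
      refine ⟨a :: z, ?_, ?_, ?_⟩
      · intro b hb
        rcases List.mem_cons.1 hb with rfl | hb
        · exact Finset.mem_union_left _ haX
        · exact hz b hb
      · rw [← hzX]
        simp [proj, haX]
      · rw [← hzY]
        simp [proj, haY]

/-- A family of strings with the same projection to an alphabet containing all shared letters
has a common interleaving. -/
theorem exists_merge_family {ι : Type} [DecidableEq ι] (E : ι → Finset A) (Ek : Finset A)
    (hs : ∀ i j, i ≠ j → E i ∩ E j ⊆ Ek) (u : ι → List A) (v : List A)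
    (hu : ∀ i, u i ∈ star (E i ∪ Ek)) (hv : v ∈ star Ek) (huv : ∀ i, proj Ek (u i) = v)
    (S : Finset ι) :
    ∃ z ∈ star (S.sup E ∪ Ek), proj Ek z = v ∧ ∀ i ∈ S, proj (E i ∪ Ek) z = u i := by
  induction S using Finset.induction_on with
  | empty => exact ⟨v, by simpa using hv, proj_eq_self hv, by simp⟩
  | insert i S hi ih =>
    obtain ⟨x, hx, hxv, hxu⟩ := ih
    have hEk : ∀ a ∈ S.sup E ∪ Ek, a ∈ E i ∪ Ek → a ∈ Ek := by
      intro a ha hai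
      rcases Finset.mem_union.1 ha with ha | ha
      · rcases Finset.mem_union.1 hai with hai | hai
        · obtain ⟨j, hj, haj⟩ := Finset.mem_sup.1 ha
          exact hs i j (by rintro rfl; exact hi hj) (Finset.mem_inter.2 ⟨hai, haj⟩)
        · exact hai
      · exact ha
    have h₁ : proj (E i ∪ Ek) x = proj Ek x := by
      refine List.filter_congr fun a ha => decide_eq_decide.2 ⟨hEk a (hx a ha), ?_⟩
      exact fun h => Finset.mem_union_right _ h
    have h₂ : proj (S.sup E ∪ Ek) (u i) = proj Ek (u i) := by
      refine List.filter_congr fun a ha => decide_eq_decide.2 ⟨fun h => hEk a h (hu i a ha), ?_⟩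
      exact fun h => Finset.mem_union_right _ h
    obtain ⟨z, hz, hzx, hzu⟩ := exists_merge (S.sup E ∪ Ek) (E i ∪ Ek) x (u i) hx (hu i)
      (by rw [h₁, h₂, hxv, huv])
    refine ⟨z, star_mono_s15 ?_ hz, ?_, ?_⟩
    · intro a
      simp only [Finset.sup_insert, Finset.sup_eq_union, Finset.mem_union]
      tauto
    · rw [← hxv, ← hzx, proj_proj_of_subset Finset.subset_union_right]
    · intro j hj
      rcases Finset.mem_insert.1 hj with rfl | hj
      · exact hzu
      · rw [← hxu j hj, ← hzx, proj_proj_of_subset]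
        exact Finset.union_subset_union_left (Finset.le_sup (f := E) hj)

/-- Lemma 9: if each projection `P^{i+k}_k : E_{i+k}* → E_k*`
is a `P_{i+k}(K)`-observer, where `K = K₁ ∥ ⋯ ∥ Kₙ ∥ K_k`, then
`overline(K)` is conditionally decomposable w.r.t. `E₁, …, Eₙ, E_k`. -/
theorem stmt15 {A : Type} [DecidableEq A] {n : ℕ} (hn : 2 ≤ n)
    (E : Fin n → Finset A) (Ek : Finset A)
    (hs : ∀ i j, i ≠ j → E i ∩ E j ⊆ Ek)
    (hkE : Ek ⊆ Finset.univ.sup E)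
    (K : Fin n → Set (List A)) (Kk : Set (List A))
    (hKE : ∀ i, K i ⊆ star (E i)) (hKkE : Kk ⊆ star Ek)
    (GK : Set (List A))
    (hGK : GK = par (Finset.univ.sup E) Ek (parFam E K) Kk)
    (hobs : ∀ i, observer (E i ∪ Ek) Ek (proj (E i ∪ Ek) '' GK)) :
    condDecomp E Ek (pref GK) := by
  have hsup : (Finset.univ.sup fun i => E i ∪ Ek) ⊆ Finset.univ.sup E :=
    Finset.sup_le fun i hi => Finset.union_subset (Finset.le_sup (f := E) hi) hkE
  have hsup' : Finset.univ.sup E ⊆ Finset.univ.sup fun i => E i ∪ Ek :=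
    Finset.sup_mono_fun fun i _ => Finset.subset_union_left
  have hunion : Finset.univ.sup E ∪ Ek = Finset.univ.sup E := Finset.union_eq_left.2 hkE
  have hmem : ∀ w, w ∈ GK ↔
      w ∈ star (Finset.univ.sup E) ∧ (∀ i, proj (E i) w ∈ K i) ∧ proj Ek w ∈ Kk := by
    intro w
    simp only [hGK, par, parFam, invProj, hunion, Set.mem_inter_iff, Set.mem_ofPred_eq]
    constructor
    · rintro ⟨⟨hw, -, h⟩, -, hk⟩
      exact ⟨hw, fun i => by
        rw [← proj_proj_of_subset (Finset.le_sup (f := E) (Finset.mem_univ i))]; exact h i, hk⟩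
    · rintro ⟨hw, h, hk⟩
      rw [proj_eq_self hw]
      exact ⟨⟨hw, hw, h⟩, hw, hk⟩
  refine Set.Subset.antisymm ?_ ?_
  · rintro w ⟨u, hu⟩
    exact ⟨star_mono_s15 hsup' (append_mem_star.1 ((hmem _).1 hu).1).1, fun i => ⟨w, ⟨u, hu⟩, rfl⟩⟩
  · rintro w ⟨hw, hproj⟩
    have hprojk : ∀ i x, proj (E i ∪ Ek) x = proj (E i ∪ Ek) w → proj Ek x = proj Ek w := by
      intro i x h
      rw [← proj_proj_of_subset (F := E i ∪ Ek) Finset.subset_union_right, h,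
        proj_proj_of_subset Finset.subset_union_right]
    obtain ⟨x, ⟨y, hxy⟩, hx⟩ := hproj ⟨0, by omega⟩
    have hcomp : ∀ i, ∃ u ∈ star (E i ∪ Ek), proj (E i ∪ Ek) w ++ u ∈ proj (E i ∪ Ek) '' GK ∧
        proj Ek (proj (E i ∪ Ek) w ++ u) = proj Ek (x ++ y) := by
      intro i
      refine hobs i _ ⟨_, ⟨_, hxy, rfl⟩, proj_proj_of_subset Finset.subset_union_right _⟩ _ ?_ ?_
      · obtain ⟨x', ⟨y', hxy'⟩, hx'⟩ := hproj i
        exact ⟨proj (E i ∪ Ek) y', x' ++ y', hxy', by rw [proj_append]; exact congrArg (· ++ _) hx'⟩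
      · rw [proj_proj_of_subset Finset.subset_union_right, ← hprojk _ _ hx, proj_append]
        exact List.prefix_append _ _
    choose u hu huK huk using hcomp
    have huv : ∀ i, proj Ek (u i) = proj Ek y := by
      intro i
      have h := huk i
      rw [proj_append, proj_append, proj_proj_of_subset Finset.subset_union_right,
        hprojk _ _ hx] at h
      exact List.append_cancel_left h
    have hy : proj Ek y ∈ star Ek := fun a ha => by simpa using (List.mem_filter.1 ha).2
    obtain ⟨z, hz, hzk, hzu⟩ := exists_merge_family E Ek hs u _ hu hy huv Finset.univ
    refine ⟨z, (hmem _).2 ⟨?_, fun i => ?_, ?_⟩⟩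
    · rw [hunion] at hz
      exact append_mem_star.2 ⟨star_mono_s15 hsup hw, hz⟩
    · obtain ⟨k, hk, hku⟩ := huK i
      rw [← hzu i (Finset.mem_univ i), ← proj_append] at hku
      rw [← proj_proj_of_subset (F := E i ∪ Ek) Finset.subset_union_left, ← hku,
        proj_proj_of_subset Finset.subset_union_left]
      exact ((hmem k).1 hk).2.1 i
    · rw [proj_append, hzk, ← hprojk _ _ hx, ← proj_append]
      exact ((hmem _).1 hxy).2.2

end DES
end
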